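/- arXiv:2501.07644 — 2 statements merged into one kernel-verified Lean document; each statement's English description precedes it below -/
import Mathlib

section
/- Let 1 ≤ j < k be integers and ε > 0. There exist β ∈ (0,1) and t_0 such that for every t ≥ t_0 the following holds, where T = t(k-1)+1, m̃ = t^{100k}, m = T·m̃ and M = T·m. Let G be a k-graph and let 𝒫 = {P_0,…,P_{m-1}} be m pairwise vertex-disjoint loose paths of length t in G with δ_j(G[V(𝒫)]) ≥ (δ_j^k(1)+3ε/4)·M^{k-j}, where V(𝒫) denotes the union of the vertex sets of the paths. For each i, label the two endvertices of P_i as u^i_a and u^i_b, and set U_a = {u^i_a : 0 ≤ i ≤ m-1} and U_b = {u^i_b : 0 ≤ i ≤ m-1}. Then there exists a partition 𝒴 = {Y_1,…,Y_T} of V(𝒫) into T parts, each of size m and each transverse with respect to 𝒫, such that for every h ∈ [T]: (A) |Y_h ∩ U_b| = m̃; (B) |Y_h ∩ U_a| ≤ βm; and (C) deg_G(S; Y_h) ≥ (δ_j^k(1)+5ε/8)·m^{k-j} for every j-element set S ⊆ V(𝒫). -/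
open Finset

open scoped Classical

noncomputable section

/-- A `k`-uniform hypergraph with vertices drawn from `ℕ`. -/
structure HGraph (k : ℕ) where
  verts : Finset ℕ
  edges : Finset (Finset ℕ)
  edge_sub : ∀ e ∈ edges, e ⊆ verts
  edge_card : ∀ e ∈ edges, e.card = k

namespace HGraph

variable {k : ℕ}

/-- The number of edges of `G` containing the vertex set `S`. -/
def degOn (G : HGraph k) (S : Finset ℕ) : ℕ :=
  (G.edges.filter fun e => S ⊆ e).card

/-- The relative degree `deg_G(S; W)`: edges containing `S` whose other vertices lie in `W`. -/
def degIn (G : HGraph k) (S W : Finset ℕ) : ℕ :=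
  (G.edges.filter fun e => S ⊆ e ∧ e \ S ⊆ W).card

/-- The edge set of the induced subhypergraph `G[U]`. -/
def inducedEdges (G : HGraph k) (U : Finset ℕ) : Finset (Finset ℕ) :=
  G.edges.filter fun e => e ⊆ U

/-- `δ_j(G) ≥ d`. -/
def MinDegGe (G : HGraph k) (j : ℕ) (d : ℝ) : Prop :=
  ∀ T ⊆ G.verts, T.card = j → d ≤ (G.degOn T : ℝ)

/-- `δ_j(G[U]) ≥ d`. -/
def MinDegOnGe (G : HGraph k) (j : ℕ) (U : Finset ℕ) (d : ℝ) : Prop :=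
  ∀ T ⊆ U, T.card = j → d ≤ (((G.inducedEdges U).filter fun e => T ⊆ e).card : ℝ)

end HGraph

/-- A colouring is rainbow on a set of edges if distinct edges receive distinct colours. -/
def RainbowEdges (χ : Finset ℕ → ℕ) (E : Finset (Finset ℕ)) : Prop :=
  ∀ e ∈ E, ∀ f ∈ E, χ e = χ f → e = f

/-- `χ` is globally `b`-bounded on `G`: every colour class has at most `b` edges. -/
def GloballyBounded {k : ℕ} (G : HGraph k) (χ : Finset ℕ → ℕ) (b : ℝ) : Prop :=
  ∀ c : ℕ, ((G.edges.filter fun e => χ e = c).card : ℝ) ≤ b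

/-- The number of edges of a loose Hamilton cycle of `G`. -/
def numE {k : ℕ} (G : HGraph k) : ℕ := G.verts.card / (k - 1)

/-- A loose Hamilton cycle in `G`, recorded by a cyclic ordering of the vertices:
`σ` enumerates the vertices, and the `i`-th edge consists of the `k` consecutive
vertices starting at position `i(k-1)`, so that consecutive edges share exactly one
vertex (when `(k-1) ∣ |V(G)|`). -/
structure LooseHamCycle (k : ℕ) (G : HGraph k) where
  σ : ℕ → ℕ
  injOn : Set.InjOn σ (Set.Iio G.verts.card)
  image_eq : (Finset.range G.verts.card).image σ = G.verts
  edges_mem : ∀ i < numE G,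
    (Finset.range k).image (fun r => σ ((i * (k - 1) + r) % G.verts.card)) ∈ G.edges

namespace LooseHamCycle

variable {k : ℕ} {G : HGraph k}

/-- The `i`-th edge of the cycle. -/
def cedge (H : LooseHamCycle k G) (i : ℕ) : Finset ℕ :=
  (Finset.range k).image fun r => H.σ ((i * (k - 1) + r) % G.verts.card)

/-- The edge set of the cycle. -/
def cedges (H : LooseHamCycle k G) : Finset (Finset ℕ) :=
  (Finset.range (numE G)).image H.cedge

/-- The edge set of the increasing loose path of length `t` starting at edge `i`. -/
def pEdges (H : LooseHamCycle k G) (i t : ℕ) : Finset (Finset ℕ) :=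
  (Finset.range t).image fun r => H.cedge ((i + r) % numE G)

/-- The vertex set of the increasing loose path of length `t` starting at edge `i`. -/
def pVerts (H : LooseHamCycle k G) (i t : ℕ) : Finset ℕ :=
  (Finset.range (t * (k - 1) + 1)).image fun r => H.σ ((i * (k - 1) + r) % G.verts.card)

/-- The first endvertex of the increasing loose path starting at edge `i`. -/
def pEndA (H : LooseHamCycle k G) (i : ℕ) : ℕ := H.σ ((i * (k - 1)) % G.verts.card)

/-- The last endvertex of the increasing loose path of length `t` starting at edge `i`. -/
def pEndB (H : LooseHamCycle k G) (i t : ℕ) : ℕ :=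
  H.σ ((i * (k - 1) + t * (k - 1)) % G.verts.card)

/-- The endvertex pair of the increasing loose path of length `t` starting at edge `i`. -/
def pEnds (H : LooseHamCycle k G) (i t : ℕ) : Finset ℕ := {H.pEndA i, H.pEndB i t}

end LooseHamCycle

/-- The loose Hamilton cycle threshold `δ_j^k(1)`: the least `δ ≥ 0` such that for every
`ε > 0` all sufficiently large `k`-graphs `G` (with `(k-1) ∣ n`) satisfying
`δ_j(G) ≥ (δ+ε)n^{k-j}` contain a loose Hamilton cycle. -/
noncomputable def looseHamThreshold (j k : ℕ) : ℝ :=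
  sInf {δ : ℝ | 0 ≤ δ ∧ ∀ ε : ℝ, 0 < ε → ∃ n₀ : ℕ, ∀ n : ℕ, n₀ ≤ n → (k - 1) ∣ n →
    ∀ G : HGraph k, G.verts.card = n →
      G.MinDegGe j ((δ + ε) * (n : ℝ) ^ (k - j)) → Nonempty (LooseHamCycle k G)}

/-- `T = t(k-1)+1`. -/
def TOf (k t : ℕ) : ℕ := t * (k - 1) + 1
/-- `m̃ = t^{100k}`. -/
def mtOf (k t : ℕ) : ℕ := t ^ (100 * k)
/-- `m = T·m̃`. -/
def mOf (k t : ℕ) : ℕ := TOf k t * mtOf k t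
/-- `M = T·m`. -/
def MOf (k t : ℕ) : ℕ := TOf k t * mOf k t

section Splittings

variable {k : ℕ} {G : HGraph k}

/-- `I` is the index set of a `t`-balanced splitting of `H`: a collection of
pairwise vertex-disjoint increasing loose paths of length `t` of `H`. -/
def IsSplitting (H : LooseHamCycle k G) (t : ℕ) (I : Finset ℕ) : Prop :=
  (∀ i ∈ I, i < numE G) ∧
    ∀ i ∈ I, ∀ i' ∈ I, i ≠ i' → Disjoint (H.pVerts i t) (H.pVerts i' t)

/-- `V(𝒫)` for the splitting indexed by `I`. -/
def splitVerts (H : LooseHamCycle k G) (t : ℕ) (I : Finset ℕ) : Finset ℕ :=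
  I.biUnion fun i => H.pVerts i t

/-- `V^E(𝒫)` for the splitting indexed by `I`. -/
def splitEnds (H : LooseHamCycle k G) (t : ℕ) (I : Finset ℕ) : Finset ℕ :=
  I.biUnion fun i => H.pEnds i t

/-- `V^I(𝒫)` for the splitting indexed by `I`. -/
def splitInt (H : LooseHamCycle k G) (t : ℕ) (I : Finset ℕ) : Finset ℕ :=
  splitVerts H t I \ splitEnds H t I

/-- A vertex set `S` is transverse with respect to the splitting indexed by `I`. -/
def Transverse (H : LooseHamCycle k G) (t : ℕ) (I : Finset ℕ) (S : Finset ℕ) : Prop :=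
  ∀ i ∈ I, (S ∩ H.pVerts i t).card ≤ 1

/-- The splitting indexed by `I` is suitable for the path `P₀` (the increasing path
of length `t` starting at edge `i₀`). -/
def Suitable (χ : Finset ℕ → ℕ) (ε : ℝ) (m : ℕ) (H : LooseHamCycle k G)
    (t : ℕ) (I : Finset ℕ) (i₀ : ℕ) : Prop :=
  (∀ S ⊆ splitVerts H t I \ H.pVerts i₀ t, S.card = k - 1 → Transverse H t I S →
    ((((G.inducedEdges (splitVerts H t I)).filter
        fun e => S ⊆ e ∧ ∃ f ∈ H.cedges, χ f = χ e).card : ℝ) ≤ ε * (m : ℝ) / 4)) ∧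
  (∀ X ⊆ splitVerts H t I \ H.pVerts i₀ t, Transverse H t I X →
    ∀ e ∈ G.inducedEdges X, ∀ f ∈ G.inducedEdges X,
      χ e = χ f → (e ∩ f).card = 1 → False) ∧
  (∀ e ∈ G.inducedEdges (splitVerts H t I \ H.pVerts i₀ t),
    ∀ f ∈ G.inducedEdges (splitVerts H t I \ H.pVerts i₀ t),
      χ e = χ f → Disjoint e f → Transverse H t I e → Transverse H t I f →
      ∃ i ∈ I, ∃ i' ∈ I, i ≠ i' ∧
        (H.pVerts i t ∩ e).Nonempty ∧ (H.pVerts i t ∩ f).Nonempty ∧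
        (H.pVerts i' t ∩ e).Nonempty ∧ (H.pVerts i' t ∩ f).Nonempty)

/-- The cyclic successor of `i` within the index set `I`. -/
def nextIdx (I : Finset ℕ) (i : ℕ) : ℕ :=
  if h : (I.filter fun i' => i < i').Nonempty then (I.filter fun i' => i < i').min' h
  else if h2 : I.Nonempty then I.min' h2 else 0

/-- `M` is a rerouting of the splitting indexed by `I`: a partition of `V^E(𝒫)` into
pairs such that identifying the two vertices of each pair connects the paths of
`H[V(G) ∖ V^I(𝒫)]` into a single loose cycle (the arcs of `H` between consecutive
paths of the splitting, together with the identified pairs, form a connected graph). -/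
def IsRerouting (H : LooseHamCycle k G) (t : ℕ) (I : Finset ℕ)
    (M : Finset (Finset ℕ)) : Prop :=
  (∀ p ∈ M, p.card = 2 ∧ p ⊆ splitEnds H t I) ∧
  (∀ p ∈ M, ∀ q ∈ M, p ≠ q → Disjoint p q) ∧
  M.biUnion id = splitEnds H t I ∧
  ∀ u ∈ splitEnds H t I, ∀ v ∈ splitEnds H t I,
    Relation.ReflTransGen
      (fun a b => ({a, b} : Finset ℕ) ∈ M ∨
        ∃ i ∈ I, ({a, b} : Finset ℕ) = {H.pEndB i t, H.pEndA (nextIdx I i)}) u v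

/-- `X` (indexed over `Finset.range T`) is a viable partition of `V(𝒫)` for the
`t`-balanced splitting indexed by `I`. -/
def IsViablePartition (j : ℕ) (ε : ℝ) (t : ℕ) (H : LooseHamCycle k G)
    (I : Finset ℕ) (X : ℕ → Finset ℕ) : Prop :=
  (Finset.range (TOf k t)).biUnion X = splitVerts H t I ∧
  (∀ h ∈ Finset.range (TOf k t), ∀ h' ∈ Finset.range (TOf k t), h ≠ h' →
    Disjoint (X h) (X h')) ∧
  (∀ h ∈ Finset.range (TOf k t), Transverse H t I (X h)) ∧
  (∃ M : Finset (Finset ℕ), IsRerouting H t I M ∧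
    ∀ h ∈ Finset.range (TOf k t), (M.filter fun p => p ⊆ X h).card = mtOf k t) ∧
  ∀ h ∈ Finset.range (TOf k t),
    G.MinDegOnGe j (X h) ((looseHamThreshold j k + ε / 2) * (mOf k t : ℝ) ^ (k - j))

/-- The vertex set spanned by a set of edges. -/
def eVerts (E : Finset (Finset ℕ)) : Finset ℕ := E.biUnion id

/-- `(𝒫, H', 𝒫')` is a `(P₀,H)`-switching of size `m`, where `𝒫` is the `t`-balanced
splitting of `H` indexed by `I` containing `P₀` (the increasing path of length `t`
starting at edge `i₀`), and `𝒫'` is the `2t`-bounded splitting of `H'` whose paths are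
recorded in `Q` as pairs (edge set, endvertex pair). -/
def IsSwitching (t m : ℕ) (H : LooseHamCycle k G) (i₀ : ℕ) (I : Finset ℕ)
    (H' : LooseHamCycle k G) (Q : Finset (Finset (Finset ℕ) × Finset ℕ)) : Prop :=
  IsSplitting H t I ∧ I.card = m ∧ i₀ ∈ I ∧
  Q.card = m ∧
  (∀ q ∈ Q, ∃ i ℓ : ℕ, i < numE G ∧ 1 ≤ ℓ ∧ ℓ ≤ 2 * t ∧
    q.1 = H'.pEdges i ℓ ∧ q.2 = H'.pEnds i ℓ) ∧
  (∀ q ∈ Q, ∀ q' ∈ Q, q ≠ q' → Disjoint (eVerts q.1) (eVerts q'.1)) ∧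
  splitInt H t I = (Q.biUnion fun q => eVerts q.1) \ (Q.biUnion fun q => q.2) ∧
  H.cedges.filter (fun e => e ⊆ G.verts \ splitInt H t I) =
    H'.cedges.filter (fun e =>
      e ⊆ G.verts \ ((Q.biUnion fun q => eVerts q.1) \ (Q.biUnion fun q => q.2))) ∧
  ∀ q ∈ Q, (H.pVerts i₀ t ∩ eVerts q.1).card ≤ 1

/-- A feasible `(P₀,H)`-switching: additionally `F' = H'[V(𝒫') ∖ V(P₀)]` is rainbow and
no edge of `F'` shares a colour with an edge of `H[V(G) ∖ V^I(𝒫)]`. -/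
def IsFeasibleSwitching (χ : Finset ℕ → ℕ) (t m : ℕ) (H : LooseHamCycle k G)
    (i₀ : ℕ) (I : Finset ℕ) (H' : LooseHamCycle k G)
    (Q : Finset (Finset (Finset ℕ) × Finset ℕ)) : Prop :=
  IsSwitching t m H i₀ I H' Q ∧
  RainbowEdges χ (H'.cedges.filter fun e =>
    e ⊆ (Q.biUnion fun q => eVerts q.1) \ H.pVerts i₀ t) ∧
  ∀ e ∈ H'.cedges.filter (fun e =>
      e ⊆ (Q.biUnion fun q => eVerts q.1) \ H.pVerts i₀ t),
    ∀ f ∈ H.cedges.filter (fun f => f ⊆ G.verts \ splitInt H t I), χ e ≠ χ f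

/-- Two vertices are close (with respect to `H` and `t`) if they lie in edges of `H`
both contained in a loose path of `H` of length at most `2t+1`. -/
def Close (H : LooseHamCycle k G) (t : ℕ) (u v : ℕ) : Prop :=
  ∃ i < numE G, ∃ i' < numE G, u ∈ H.cedge i ∧ v ∈ H.cedge i' ∧
    ∃ d ≤ 2 * t, (i + d) % numE G = i' ∨ (i' + d) % numE G = i

/-- A vertex set is spread if no two of its vertices are close. -/
def SpreadSet (H : LooseHamCycle k G) (t : ℕ) (S : Finset ℕ) : Prop :=
  ∀ u ∈ S, ∀ v ∈ S, u ≠ v → ¬ Close H t u v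

/-- A vertex set is almost spread if exactly one pair of its vertices is close. -/
def AlmostSpreadSet (H : LooseHamCycle k G) (t : ℕ) (S : Finset ℕ) : Prop :=
  ∃ u ∈ S, ∃ v ∈ S, u ≠ v ∧ Close H t u v ∧
    ∀ u' ∈ S, ∀ v' ∈ S, u' ≠ v' → Close H t u' v' → ({u', v'} : Finset ℕ) = {u, v}

end Splittings

/-- The probability that a `p`-random subset of `Finset.range N` (each element included
independently with probability `p`) satisfies `A`. -/
noncomputable def probOver (N : ℕ) (p : ℝ) (A : Finset ℕ → Prop) : ℝ :=
  ∑ S ∈ (Finset.range N).powerset,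
    if A S then p ^ S.card * (1 - p) ^ (N - S.card) else 0

/-- A loose path of length `t` in `G`, recorded by an ordering of its vertices. -/
structure LoosePath (k t : ℕ) (G : HGraph k) where
  σ : ℕ → ℕ
  injOn : Set.InjOn σ (Set.Iio (t * (k - 1) + 1))
  mem_verts : ∀ r < t * (k - 1) + 1, σ r ∈ G.verts
  edges_mem : ∀ i < t, (Finset.range k).image (fun r => σ (i * (k - 1) + r)) ∈ G.edges

namespace LoosePath

variable {k t : ℕ} {G : HGraph k}

/-- The vertex set of a loose path. -/
def verts (P : LoosePath k t G) : Finset ℕ := (Finset.range (t * (k - 1) + 1)).image P.σ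

/-- The edge set of a loose path. -/
def edgeSet (P : LoosePath k t G) : Finset (Finset ℕ) :=
  (Finset.range t).image fun i => (Finset.range k).image fun r => P.σ (i * (k - 1) + r)

/-- The first endvertex of a loose path. -/
def endA (P : LoosePath k t G) : ℕ := P.σ 0

/-- The last endvertex of a loose path. -/
def endB (P : LoosePath k t G) : ℕ := P.σ (t * (k - 1))

end LoosePath


lemma aux_exp (y : ℝ) : Real.exp y ≤ y + Real.exp (y ^ 2) := by
  have h2 := Real.add_one_le_exp (y ^ 2)
  by_cases h : |y| ≤ 1
  · have h1 := Real.abs_exp_sub_one_sub_id_le h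
    have := (abs_le.1 h1).2
    linarith
  · rcases le_or_gt 0 y with h0 | h0
    · rw [abs_of_nonneg h0] at h
      have : Real.exp y ≤ Real.exp (y ^ 2) := Real.exp_le_exp.2 (by nlinarith)
      linarith
    · rw [abs_of_neg h0] at h
      have : Real.exp y ≤ 1 := Real.exp_le_one_iff.2 h0.le
      nlinarith

lemma aux_one {A : Type*} [Fintype A] [Nonempty A] (D : ℝ) (x : A → ℝ)
    (hx : ∀ a b, x a - x b ≤ D) :
    ∑ a, Real.exp (x a) ≤
      Fintype.card A * Real.exp ((∑ a, x a) / Fintype.card A + D ^ 2) := by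
  have hc : (0 : ℝ) < Fintype.card A := by exact_mod_cast Fintype.card_pos
  set μ := (∑ a, x a) / Fintype.card A with hμ
  have hμ' : ∑ a, x a = Fintype.card A * μ := by rw [hμ]; field_simp
  have hdev : ∀ a, (x a - μ) ^ 2 ≤ D ^ 2 := by
    intro a
    have h1 : Fintype.card A * (x a - μ) ≤ Fintype.card A * D := by
      have : ∑ b, (x a - x b) ≤ ∑ _b : A, D := Finset.sum_le_sum fun b _ => hx a b
      simp [Finset.sum_sub_distrib] at this
      rw [hμ'] at this; linarith
    have h2 : Fintype.card A * (μ - x a) ≤ Fintype.card A * D := by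
      have : ∑ b, (x b - x a) ≤ ∑ _b : A, D := Finset.sum_le_sum fun b _ => hx b a
      simp [Finset.sum_sub_distrib] at this
      rw [hμ'] at this; linarith
    have h1 := le_of_mul_le_mul_left h1 hc
    have h2 := le_of_mul_le_mul_left h2 hc
    nlinarith
  have key : ∑ a, Real.exp (x a - μ) ≤ Fintype.card A * Real.exp (D ^ 2) := by
    calc ∑ a, Real.exp (x a - μ) ≤ ∑ a, ((x a - μ) + Real.exp (D ^ 2)) := by
          apply Finset.sum_le_sum; intro a _
          have := aux_exp (x a - μ)
          have := Real.exp_le_exp.2 (hdev a)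
          linarith
      _ = _ := by
          simp [Finset.sum_add_distrib, Finset.sum_sub_distrib]; rw [hμ']; ring
  have : ∑ a, Real.exp (x a) = Real.exp μ * ∑ a, Real.exp (x a - μ) := by
    rw [Finset.mul_sum]; refine Finset.sum_congr rfl fun a _ => ?_
    rw [← Real.exp_add]; congr 1; ring
  rw [this, Real.exp_add]
  have := mul_le_mul_of_nonneg_left key (Real.exp_pos μ).le
  linarith

lemma aux_mgf {A : Type*} [Fintype A] [Nonempty A] (D : ℝ) : ∀ (N : ℕ) (f : (Fin N → A) → ℝ),
    (∀ g c c', (∀ i, i ≠ g → c i = c' i) → f c - f c' ≤ D) →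
    ∑ c, Real.exp (f c) ≤
      (Fintype.card A : ℝ) ^ N * Real.exp ((∑ c, f c) / (Fintype.card A : ℝ) ^ N + N * D ^ 2) := by
  intro N
  have hc : (0 : ℝ) < Fintype.card A := by exact_mod_cast Fintype.card_pos
  induction N with
  | zero => intro f _; simp
  | succ N ih =>
    intro f hf
    have split : ∀ F : (Fin (N + 1) → A) → ℝ, ∑ c, F c = ∑ a : A, ∑ c : Fin N → A,
        F (Fin.cons a c) := by
      intro F
      rw [← Fintype.sum_prod_type']
      exact (Fintype.sum_equiv (Fin.consEquiv fun _ => A) _ _ (fun p => rfl)).symm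
    rw [split, split f]
    have h1 : ∀ a : A, ∑ c : Fin N → A, Real.exp (f (Fin.cons a c)) ≤
        (Fintype.card A : ℝ) ^ N * Real.exp ((∑ c : Fin N → A, f (Fin.cons a c)) /
          (Fintype.card A : ℝ) ^ N + N * D ^ 2) := by
      intro a
      apply ih
      intro g c c' h
      apply hf g.succ
      intro i
      refine Fin.cases ?_ ?_ i
      · simp
      · intro i hi; simp; apply h; rintro rfl; exact hi rfl
    have h2 := aux_one D (fun a => (∑ c : Fin N → A, f (Fin.cons a c)) /
          (Fintype.card A : ℝ) ^ N) (by
      intro a b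
      rw [← sub_div, div_le_iff₀ (by positivity), ← Finset.sum_sub_distrib]
      calc _ ≤ ∑ _c : Fin N → A, D := by
            apply Finset.sum_le_sum; intro c _
            apply hf 0
            intro i
            refine Fin.cases ?_ ?_ i
            · simp
            · intro i _; simp
        _ = _ := by simp; ring)
    calc _ ≤ ∑ a : A, (Fintype.card A : ℝ) ^ N * Real.exp ((∑ c : Fin N → A, f (Fin.cons a c)) /
          (Fintype.card A : ℝ) ^ N + N * D ^ 2) := Finset.sum_le_sum fun a _ => h1 a
      _ = (Fintype.card A : ℝ) ^ N * Real.exp (N * D ^ 2) * ∑ a : A, Real.exp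
          ((∑ c : Fin N → A, f (Fin.cons a c)) / (Fintype.card A : ℝ) ^ N) := by
          rw [Finset.mul_sum]; refine Finset.sum_congr rfl fun a _ => ?_
          rw [Real.exp_add]; ring
      _ ≤ _ := mul_le_mul_of_nonneg_left h2 (by positivity)
      _ = _ := by
          rw [← Finset.sum_div, div_div, Real.exp_add, Real.exp_add]
          push_cast
          rw [add_mul, Real.exp_add, one_mul, ← pow_succ]; ring

lemma aux_bad {α : Type*} (V : Finset α) {N : ℕ} (grp : α → Fin N) (K l M : ℕ)
    (hV : V.card ≤ M) (hM : K * N = M)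
    (hK : ∀ g, (V.filter fun v => grp v = g).card ≤ K) :
    ((powersetCard l V).filter fun f : Finset α => ¬ Set.InjOn grp (f : Set α)).card * N ≤ M ^ l := by
  set B := (powersetCard l V).filter fun f : Finset α => ¬ Set.InjOn grp (f : Set α) with hB
  have hmem : ∀ f ∈ B, f ⊆ V ∧ f.card = l ∧ ∃ u ∈ f, ∃ v ∈ f, grp u = grp v ∧ u ≠ v := by
    intro f hf
    rw [hB, mem_filter, mem_powersetCard] at hf
    refine ⟨hf.1.1, hf.1.2, ?_⟩
    have := hf.2
    simp only [Set.InjOn] at this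
    push Not at this
    obtain ⟨u, hu, v, hv, h1, h2⟩ := this
    exact ⟨u, by simpa using hu, v, by simpa using hv, h1, h2⟩
  by_cases hl : l < 2
  · have : B = ∅ := by
      rw [eq_empty_iff_forall_notMem]
      intro f hf
      obtain ⟨_, h2, u, hu, v, hv, _, h3⟩ := hmem f hf
      have : 1 < f.card := one_lt_card.2 ⟨u, hu, v, hv, h3⟩
      omega
    simp [this]
  · obtain ⟨r, rfl⟩ : ∃ r, l = r + 2 := ⟨l - 2, by omega⟩
    have hsub : B ⊆ ((V.sigma (fun u => V.filter (fun v => grp v = grp u))) ×ˢ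
        powersetCard r V).image (fun p => insert p.1.1 (insert p.1.2 p.2)) := by
      intro f hf
      obtain ⟨h1, h2, u, hu, v, hv, h4, h3⟩ := hmem f hf
      rw [mem_image]
      refine ⟨(⟨u, v⟩, (f.erase u).erase v), ?_, ?_⟩
      · simp only [mem_product, mem_sigma, mem_filter, mem_powersetCard]
        refine ⟨⟨h1 hu, h1 hv, h4.symm⟩, ((erase_subset _ _).trans (erase_subset _ _)).trans h1, ?_⟩
        rw [card_erase_of_mem (mem_erase.2 ⟨h3.symm, hv⟩), card_erase_of_mem hu]; omega
      · simp only
        rw [insert_erase (mem_erase.2 ⟨h3.symm, hv⟩), insert_erase hu]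
    have hc : B.card ≤ M * K * M ^ r := by
      refine (card_le_card hsub).trans (card_image_le.trans ?_)
      rw [card_product, card_sigma, card_powersetCard]
      refine Nat.mul_le_mul ?_ ?_
      · refine (sum_le_card_nsmul _ _ K fun u _ => hK _).trans ?_
        rw [smul_eq_mul]; exact Nat.mul_le_mul_right _ hV
      · exact (Nat.choose_le_pow _ _).trans (Nat.pow_le_pow_left hV _)
    calc B.card * N ≤ M * K * M ^ r * N := Nat.mul_le_mul_right _ hc
      _ = M * (K * N) * M ^ r := by ring
      _ = _ := by rw [hM]; ring

lemma aux_diff {α : Type*} (Y W : Finset α) (T m l : ℕ) (hY : Y.card ≤ m)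
    (hT : W.card ≤ T) (F : Finset (Finset α)) (hF : ∀ f ∈ F, f ⊆ Y ∧ f.card = l ∧ ¬ Disjoint f W) :
    F.card ≤ T * m ^ (l - 1) := by
  have hsub : F ⊆ (W ×ˢ powersetCard (l - 1) Y).image (fun p => insert p.1 p.2) := by
    intro f hf
    obtain ⟨h1, h2, h3⟩ := hF f hf
    rw [not_disjoint_iff] at h3
    obtain ⟨v, hv, hvW⟩ := h3
    rw [mem_image]
    refine ⟨(v, f.erase v), ?_, insert_erase hv⟩
    simp only [mem_product, mem_powersetCard]
    exact ⟨hvW, (erase_subset _ _).trans h1, by rw [card_erase_of_mem hv, h2]⟩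
  refine (card_le_card hsub).trans (card_image_le.trans ?_)
  rw [card_product, card_powersetCard]
  exact Nat.mul_le_mul hT ((Nat.choose_le_pow _ _).trans (Nat.pow_le_pow_left hY _))

lemma aux_count {α : Type*} {N T : ℕ} [NeZero T] (grp : α → Fin N) (off : α → Fin T)
    (f : Finset α) (hf : Set.InjOn grp (f : Set α)) (h : Fin T) :
    (univ.filter fun c : Fin N → Fin T => ∀ v ∈ f, off v + c (grp v) = h).card * T ^ f.card
      = T ^ N := by
  set s : Fin N → Finset (Fin T) := fun g =>
    univ.filter fun a => ∀ v ∈ f, grp v = g → off v + a = h with hs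
  have h1 : (univ.filter fun c : Fin N → Fin T => ∀ v ∈ f, off v + c (grp v) = h) =
      Fintype.piFinset s := by
    ext c
    simp only [hs, mem_filter, mem_univ, true_and, Fintype.mem_piFinset]
    constructor
    · rintro H g v hv rfl; exact H v hv
    · intro H v hv; exact H _ v hv rfl
  have h2 : T ^ f.card = ∏ g : Fin N, if g ∈ f.image grp then T else 1 := by
    rw [prod_ite_mem, univ_inter, prod_const, card_image_of_injOn hf]
  rw [h1, Fintype.card_piFinset, h2, ← prod_mul_distrib]
  have h3 : ∀ g, (s g).card * (if g ∈ f.image grp then T else 1) = T := by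
    intro g
    split_ifs with hg
    · rw [mem_image] at hg
      obtain ⟨v, hv, rfl⟩ := hg
      have : s (grp v) = {h - off v} := by
        ext a
        simp only [hs, mem_filter, mem_univ, true_and, mem_singleton]
        constructor
        · intro H; rw [← H v hv rfl]; abel
        · rintro rfl w hw hwv
          rw [hf (by simpa using hw) (by simpa using hv) hwv]; abel
      simp [this]
    · have : s g = univ := by
        ext a
        simp only [hs, mem_filter, mem_univ, true_and, iff_true]
        intro v hv hvg
        exact absurd (mem_image.2 ⟨v, hv, hvg⟩) hg
      simp [this]
  rw [prod_congr rfl fun g _ => h3 g]; simp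

/-- The function whose concentration is needed. -/
def auxI {α : Type*} {N T : ℕ} (grp : α → Fin N) (off : α → Fin T)
    (F : Finset (Finset α)) (h : Fin T) (c : Fin N → Fin T) : ℕ :=
  (F.filter fun f => ∀ v ∈ f, off v + c (grp v) = h).card

lemma aux_Y {α : Type*} {N T : ℕ} [NeZero T] (V : Finset α) (grp : α → Fin N) (off : α → Fin T)
    (hfib : ∀ g a, (V.filter fun v => grp v = g ∧ off v = a).card ≤ T) (h : Fin T)
    (c : Fin N → Fin T) (g : Fin N) :
    (V.filter fun v => off v + c (grp v) = h ∧ grp v = g).card ≤ T := by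
  refine (card_le_card ?_).trans (hfib g (h - c g))
  intro v
  simp only [mem_filter]
  rintro ⟨h1, h2, rfl⟩
  refine ⟨h1, rfl, ?_⟩
  rw [← h2]; abel

lemma aux_card_fiber {α : Type*} {N : ℕ} (s : Finset α) (grp : α → Fin N) (K : ℕ)
    (h : ∀ g, (s.filter fun v => grp v = g).card ≤ K) : s.card ≤ K * N := by
  have := card_eq_sum_card_fiberwise (f := grp) (s := s) (t := univ) (fun _ _ => by simp)
  rw [this]
  refine (sum_le_card_nsmul _ _ K fun g _ => h g).trans ?_
  simp [mul_comm]

lemma aux_bdd {α : Type*} {N T : ℕ} [NeZero T] (V : Finset α) (grp : α → Fin N) (off : α → Fin T)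
    (hfib : ∀ g a, (V.filter fun v => grp v = g ∧ off v = a).card ≤ T)
    (F : Finset (Finset α)) (l : ℕ) (hF : ∀ f ∈ F, f ⊆ V ∧ f.card = l) (h : Fin T)
    (g : Fin N) (c c' : Fin N → Fin T) (hc : ∀ i, i ≠ g → c i = c' i) :
    auxI grp off F h c ≤ auxI grp off F h c' + T * (T * N) ^ (l - 1) := by
  set Y := V.filter fun v => off v + c (grp v) = h with hY
  set W := Y.filter fun v => grp v = g with hW
  have hWc : ∀ g, (Y.filter fun v => grp v = g).card ≤ T := by
    intro g; rw [hY, filter_filter]; exact aux_Y V grp off hfib h c g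
  have hYc : Y.card ≤ T * N := aux_card_fiber Y grp T hWc
  have hd := aux_diff Y W T (T * N) l hYc (hWc g)
    ((F.filter fun f => ∀ v ∈ f, off v + c (grp v) = h).filter fun f => ¬ Disjoint f W) (by
      intro f hf
      simp only [mem_filter] at hf
      refine ⟨?_, (hF f hf.1.1).2, hf.2⟩
      intro v hv
      exact mem_filter.2 ⟨(hF f hf.1.1).1 hv, hf.1.2 v hv⟩)
  have hs := card_filter_add_card_filter_not (s := F.filter fun f => ∀ v ∈ f, off v + c (grp v) = h)
    (fun f => Disjoint f W)
  have hle : ((F.filter fun f => ∀ v ∈ f, off v + c (grp v) = h).filter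
      fun f => Disjoint f W).card ≤ auxI grp off F h c' := by
    refine card_le_card ?_
    intro f
    simp only [mem_filter]
    rintro ⟨⟨h1, h2⟩, h3⟩
    refine ⟨h1, fun v hv => ?_⟩
    rw [← hc, h2 v hv]
    intro hg
    refine (disjoint_left.1 h3) hv ?_
    exact mem_filter.2 ⟨mem_filter.2 ⟨(hF f h1).1 hv, h2 v hv⟩, hg⟩
  unfold auxI at hle ⊢
  omega

lemma aux_mean {α : Type*} {N T : ℕ} [NeZero T] (V : Finset α) (grp : α → Fin N) (off : α → Fin T)
    (hfib : ∀ g a, (V.filter fun v => grp v = g ∧ off v = a).card ≤ T)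
    (F : Finset (Finset α)) (l : ℕ) (hF : ∀ f ∈ F, f ⊆ V ∧ f.card = l) (h : Fin T) (hN : 0 < N)
    (d : ℝ) (hd : d * ((T : ℝ) * (T * N)) ^ l ≤ F.card) :
    (d - 1 / N) * ((T : ℝ) * N) ^ l * (T : ℝ) ^ N ≤ ∑ c, (auxI grp off F h c : ℝ) := by
  have hT : 0 < T := Nat.pos_of_neZero T
  have hKf : ∀ g, (V.filter fun v => grp v = g).card ≤ T * T := by
    intro g
    refine aux_card_fiber _ off T fun a => ?_
    rw [filter_filter]; exact hfib g a
  have hV := aux_card_fiber V grp (T * T) hKf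
  have hbad := aux_bad V grp (T * T) l (T * T * N) hV rfl hKf
  set good := F.filter fun f : Finset α => Set.InjOn grp (f : Set α) with hgood
  have h1 : F.card ≤ good.card +
      ((powersetCard l V).filter fun f : Finset α => ¬ Set.InjOn grp (f : Set α)).card := by
    rw [← card_filter_add_card_filter_not (s := F) (fun f : Finset α => Set.InjOn grp (f : Set α))]
    refine Nat.add_le_add_left (card_le_card ?_) _
    refine filter_subset_filter _ ?_
    intro f hf; exact mem_powersetCard.2 (hF f hf)
  have h2 : (∑ c, auxI grp off F h c) * T ^ l ≥ good.card * T ^ N := by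
    have : ∑ c, auxI grp off F h c = ∑ f ∈ F,
        (univ.filter fun c : Fin N → Fin T => ∀ v ∈ f, off v + c (grp v) = h).card := by
      simp only [auxI, card_filter]
      exact sum_comm
    rw [this]
    calc good.card * T ^ N = ∑ f ∈ good, T ^ N := by simp
      _ = ∑ f ∈ good, (univ.filter fun c : Fin N → Fin T =>
            ∀ v ∈ f, off v + c (grp v) = h).card * T ^ l := by
          refine sum_congr rfl fun f hf => ?_
          rw [hgood, mem_filter] at hf
          rw [← aux_count grp off f hf.2 h, (hF f hf.1).2]
      _ ≤ ∑ f ∈ F, (univ.filter fun c : Fin N → Fin T =>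
            ∀ v ∈ f, off v + c (grp v) = h).card * T ^ l :=
          sum_le_sum_of_subset (filter_subset _ _)
      _ = _ := by rw [sum_mul]
  have hNr : (0 : ℝ) < N := by exact_mod_cast hN
  have hTr : (0 : ℝ) < T := by exact_mod_cast hT
  set bad := ((powersetCard l V).filter fun f : Finset α => ¬ Set.InjOn grp (f : Set α)).card
  have h1' : (F.card : ℝ) ≤ good.card + bad := by exact_mod_cast h1
  have h2' : (good.card : ℝ) * (T : ℝ) ^ N ≤ (∑ c, (auxI grp off F h c : ℝ)) * (T : ℝ) ^ l := by
    exact_mod_cast h2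
  have hb' : (bad : ℝ) * N ≤ ((T : ℝ) * T * N) ^ l := by exact_mod_cast hbad
  have hb2 : (bad : ℝ) ≤ 1 / N * ((T : ℝ) * (T * N)) ^ l := by
    rw [one_div, inv_mul_eq_div, le_div_iff₀ hNr]; rw [← mul_assoc]; exact hb'
  have hg : (d - 1 / N) * ((T : ℝ) * (T * N)) ^ l ≤ good.card := by
    rw [sub_mul]; linarith
  have hTl : (0 : ℝ) < (T : ℝ) ^ l := by positivity
  refine le_of_mul_le_mul_right (le_trans ?_ h2') hTl
  have := mul_le_mul_of_nonneg_right hg (by positivity : (0 : ℝ) ≤ (T : ℝ) ^ N)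
  rw [mul_pow (T : ℝ) (T * N)] at this
  linarith

lemma aux_core {α ι : Type*} {N T : ℕ} [NeZero T] (V : Finset α) (grp : α → Fin N)
    (off : α → Fin T)
    (hfib : ∀ g a, (V.filter fun v => grp v = g ∧ off v = a).card ≤ T)
    (R : Finset ι) (F : ι → Finset (Finset α)) (l : ℕ) (hl : 1 ≤ l)
    (hF : ∀ i ∈ R, ∀ f ∈ F i, f ⊆ V ∧ f.card = l) (hN : 0 < N)
    (d η : ℝ) (hη : 0 < η) (hd : ∀ i ∈ R, d * ((T : ℝ) * (T * N)) ^ l ≤ (F i).card)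
    (hN1 : 1 / (N : ℝ) ≤ η / 4)
    (hsmall : (R.card : ℝ) * T * Real.exp (- (η ^ 2 / 8 * N)) < 1) :
    ∃ c : Fin N → Fin T, ∀ i ∈ R, ∀ h,
      (d - η) * ((T : ℝ) * N) ^ l ≤ (auxI grp off (F i) h c : ℝ) := by
  have hT : 0 < T := Nat.pos_of_neZero T
  have hNr : (0 : ℝ) < N := by exact_mod_cast hN
  have hTr : (0 : ℝ) < T := by exact_mod_cast hT
  set m : ℝ := ((T : ℝ) * N) ^ l with hm
  have hmpos : 0 < m := by positivity
  set Bad : ι × Fin T → Finset (Fin N → Fin T) := fun p =>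
    univ.filter fun c => (auxI grp off (F p.1) p.2 c : ℝ) < (d - η) * m with hBad
  set lam : ℝ := η * N / 2 with hlam
  have hlpos : 0 < lam := by positivity
  have hB : ∀ i ∈ R, ∀ h, ((Bad (i, h)).card : ℝ) ≤
      (T : ℝ) ^ N * Real.exp (- (η ^ 2 / 8 * N)) := by
    intro i hi h
    have hmgf := aux_mgf (A := Fin T) (lam / N) N
      (fun c => - (lam / m) * (auxI grp off (F i) h c : ℝ)) (by
        intro g c c' hcc
        have hb := aux_bdd V grp off hfib (F i) l (hF i hi) h g c' c
          (fun i hi => (hcc i hi).symm)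
        have hb' : (auxI grp off (F i) h c' : ℝ) ≤ auxI grp off (F i) h c +
          T * ((T : ℝ) * N) ^ (l - 1) := by exact_mod_cast hb
        have hmm : m = (T * ((T : ℝ) * N) ^ (l - 1)) * N := by
          rw [hm]; obtain ⟨r, rfl⟩ : ∃ r, l = r + 1 := ⟨l - 1, by omega⟩
          simp; ring
        have : lam / N = lam / m * (T * ((T : ℝ) * N) ^ (l - 1)) := by
          rw [hmm]; field_simp
        rw [this]
        have := mul_le_mul_of_nonneg_left hb' (by positivity : 0 ≤ lam / m)
        linarith)
    have hmean := aux_mean V grp off hfib (F i) l (hF i hi) h hN d (hd i hi)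
    rw [← hm] at hmean
    have hlow : ((Bad (i, h)).card : ℝ) * Real.exp (- (lam * (d - η))) ≤
        ∑ c, Real.exp (- (lam / m) * (auxI grp off (F i) h c : ℝ)) := by
      rw [← nsmul_eq_mul, ← sum_const]
      refine le_trans (sum_le_sum fun c hc => ?_)
        (sum_le_sum_of_subset_of_nonneg (subset_univ (Bad (i, h))) fun _ _ _ => (Real.exp_pos _).le)
      rw [hBad] at hc
      simp only [mem_filter] at hc
      apply Real.exp_le_exp.2
      have h1 := mul_le_mul_of_nonneg_left hc.2.le (by positivity : 0 ≤ lam / m)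
      have h2 : lam / m * ((d - η) * m) = lam * (d - η) := by field_simp
      linarith
    have hup : (∑ c, - (lam / m) * (auxI grp off (F i) h c : ℝ)) / (Fintype.card (Fin T) : ℝ) ^ N
        + N * (lam / N) ^ 2 ≤ - (lam * (d - η)) + - (η ^ 2 / 8 * N) := by
      rw [← mul_sum, Fintype.card_fin]
      have h1 : lam * (d - 1 / N) ≤ (lam / m * ∑ c, (auxI grp off (F i) h c : ℝ)) / (T : ℝ) ^ N := by
        rw [le_div_iff₀ (by positivity)]
        have h1 := mul_le_mul_of_nonneg_left hmean (by positivity : 0 ≤ lam / m)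
        have h2 : lam / m * ((d - 1 / N) * m * (T : ℝ) ^ N) = lam * (d - 1 / N) * (T : ℝ) ^ N := by
          field_simp
        linarith
      have h3 : (N : ℝ) * (lam / N) ^ 2 = lam * (η / 2) := by
        rw [hlam]; field_simp
      have h4 : η ^ 2 / 8 * N = lam * (η / 4) := by rw [hlam]; ring
      have h5 := mul_le_mul_of_nonneg_left hN1 hlpos.le
      rw [h3, h4, neg_mul, neg_div]
      nlinarith
    have := hlow.trans (hmgf.trans (mul_le_mul_of_nonneg_left (Real.exp_le_exp.2 hup)
      (by positivity)))
    rw [Real.exp_add, Fintype.card_fin] at this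
    have hp := Real.exp_pos (- (lam * (d - η)))
    refine le_of_mul_le_mul_right ?_ hp
    linarith
  by_contra hcon
  push Not at hcon
  have hcov : (univ : Finset (Fin N → Fin T)) ⊆ (R ×ˢ univ).biUnion Bad := by
    intro c _
    obtain ⟨i, hi, h, hlt⟩ := hcon c
    exact mem_biUnion.2 ⟨(i, h), mem_product.2 ⟨hi, mem_univ _⟩, mem_filter.2 ⟨mem_univ _, hlt⟩⟩
  have h1 : (T : ℝ) ^ N ≤ ∑ p ∈ R ×ˢ univ, ((Bad p).card : ℝ) := by
    have := (card_le_card hcov).trans card_biUnion_le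
    simp only [card_univ, Fintype.card_fun, Fintype.card_fin] at this
    exact_mod_cast this
  have h2 : ∑ p ∈ R ×ˢ (univ : Finset (Fin T)), ((Bad p).card : ℝ) ≤
      ∑ p ∈ R ×ˢ (univ : Finset (Fin T)), (T : ℝ) ^ N * Real.exp (- (η ^ 2 / 8 * N)) :=
    sum_le_sum fun p hp => hB p.1 (mem_product.1 hp).1 p.2
  rw [sum_const, card_product, card_univ, Fintype.card_fin, nsmul_eq_mul] at h2
  push_cast at h2
  have hTN : (0 : ℝ) < (T : ℝ) ^ N := by positivity
  nlinarith

lemma aux_geom {N T : ℕ} [NeZero T] (vert : Fin T × Fin N × Fin T → ℕ)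
    (hinj : Function.Injective vert) (hN : 0 < N)
    (R : Finset (Finset ℕ)) (F : Finset ℕ → Finset (Finset ℕ)) (l : ℕ) (hl : 1 ≤ l)
    (hF : ∀ i ∈ R, ∀ f ∈ F i, f ⊆ univ.image vert ∧ f.card = l)
    (d η : ℝ) (hη : 0 < η) (hd : ∀ i ∈ R, d * ((T : ℝ) * (T * N)) ^ l ≤ (F i).card)
    (hN1 : 1 / (N : ℝ) ≤ η / 4)
    (hsmall : (R.card : ℝ) * T * Real.exp (- (η ^ 2 / 8 * N)) < 1) :
    ∃ Y : Fin T → Finset ℕ,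
      (∀ h h', h ≠ h' → Disjoint (Y h) (Y h')) ∧
      (univ.biUnion Y = univ.image vert) ∧
      (∀ h, (Y h).card = T * N) ∧
      (∀ h q g r r', vert (q, g, r) ∈ Y h → vert (q, g, r') ∈ Y h → r = r') ∧
      (∀ h r, (Y h ∩ univ.image fun p : Fin T × Fin N => vert (p.1, p.2, r)).card = N) ∧
      (∀ h, ∀ S ∈ R, (d - η) * ((T : ℝ) * N) ^ l ≤ (((F S).filter fun f => f ⊆ Y h).card : ℝ)) := by
  haveI : Nonempty (Fin T × Fin N × Fin T) := ⟨(0, ⟨0, hN⟩, 0)⟩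
  set x := Function.invFun vert with hx
  have hxv : ∀ p, x (vert p) = p := Function.leftInverse_invFun hinj
  have hfib : ∀ (g : Fin N) (a : Fin T), ((univ.image vert).filter fun v =>
      (x v).2.1 = g ∧ (x v).1 + (x v).2.2 = a).card ≤ T := by
    intro g a
    have : T = (univ : Finset (Fin T)).card := by simp
    conv_rhs => rw [this]
    refine card_le_card_of_injOn (fun v => (x v).2.2) (fun _ _ => by simp) ?_
    intro v hv w hw hvw
    simp only [coe_filter, mem_image, mem_univ, true_and, Set.mem_setOf_eq] at hv hw hvw
    obtain ⟨⟨⟨q, g1, r⟩, rfl⟩, h1, h2⟩ := hv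
    obtain ⟨⟨⟨q', g2, r'⟩, rfl⟩, h3, h4⟩ := hw
    simp only [hxv] at *
    subst hvw h1 h3
    rw [← h2] at h4
    rw [add_right_cancel h4]
  obtain ⟨c, hc⟩ := aux_core (univ.image vert) (fun v => (x v).2.1)
    (fun v => (x v).1 + (x v).2.2) hfib R F l hl hF hN d η hη hd hN1 hsmall
  set Y : Fin T → Finset ℕ := fun h => (univ.image vert).filter fun v =>
    (x v).1 + (x v).2.2 + c (x v).2.1 = h with hY
  have hmem : ∀ h p, vert p ∈ Y h ↔ p.1 + p.2.2 + c p.2.1 = h := by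
    intro h p
    simp only [hY, mem_filter, hxv]
    simp
  refine ⟨Y, ?_, ?_, ?_, ?_, ?_, ?_⟩
  · intro h h' hne
    rw [disjoint_left]
    intro v hv hv'
    exact hne ((mem_filter.1 hv).2.symm.trans (mem_filter.1 hv').2)
  · ext v
    simp only [hY, mem_biUnion, mem_filter, mem_univ, true_and]
    constructor
    · rintro ⟨_, h, _⟩; exact h
    · intro h; exact ⟨_, h, rfl⟩
  · intro h
    have : Y h = univ.image fun p : Fin T × Fin N => vert (h - c p.2 - p.1, p.2, p.1) := by
      ext v
      constructor
      · intro hv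
        obtain ⟨⟨q, g, r⟩, _, rfl⟩ := mem_image.1 (mem_filter.1 hv).1
        rw [hmem] at hv
        refine mem_image.2 ⟨(r, g), mem_univ _, ?_⟩
        simp only at hv ⊢
        rw [← hv]; congr 2; abel
      · intro hv
        obtain ⟨⟨r, g⟩, _, rfl⟩ := mem_image.1 hv
        rw [hmem]; simp only; abel
    rw [this, card_image_of_injective]
    · simp
    · rintro ⟨r, g⟩ ⟨r', g'⟩ he
      have := hinj he
      simp only [Prod.mk.injEq] at this
      rw [this.2.1, this.2.2]
  · intro h q g r r' h1 h2
    rw [hmem] at h1 h2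
    simp only at h1 h2
    rw [← h2] at h1
    exact add_left_cancel (add_right_cancel h1)
  · intro h r
    have : (Y h ∩ univ.image fun p : Fin T × Fin N => vert (p.1, p.2, r)) =
        univ.image fun g : Fin N => vert (h - c g - r, g, r) := by
      ext v
      rw [mem_inter]
      constructor
      · rintro ⟨hv, hv2⟩
        obtain ⟨⟨q, g⟩, _, rfl⟩ := mem_image.1 hv2
        rw [hmem] at hv
        refine mem_image.2 ⟨g, mem_univ _, ?_⟩
        simp only at hv ⊢
        rw [← hv]; congr 2; abel
      · intro hv
        obtain ⟨g, _, rfl⟩ := mem_image.1 hv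
        refine ⟨?_, mem_image.2 ⟨(h - c g - r, g), mem_univ _, rfl⟩⟩
        rw [hmem]; simp only; abel
    rw [this, card_image_of_injective]
    · simp
    · intro g g' he
      have := hinj he
      simp only [Prod.mk.injEq] at this
      exact this.2.1
  · intro h S hS
    refine (hc S hS h).trans ?_
    unfold auxI
    gcongr with f hf
    intro H v hv
    exact mem_filter.2 ⟨(hF S hS f hf).1 hv, H v hv⟩

lemma aux_large (η : ℝ) (hη : 0 < η) (n : ℕ) : ∃ x₀ : ℝ, ∀ x : ℝ, x₀ ≤ x →
    1 / x ≤ η / 4 ∧ x ^ n * Real.exp (- (η ^ 2 / 8 * x)) < 1 := by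
  have h1 := (isLittleO_pow_exp_pos_mul_atTop n (b := η ^ 2 / 8) (by positivity)).bound
    (show (0 : ℝ) < 1 / 2 by norm_num)
  obtain ⟨x₁, hx₁⟩ := Filter.eventually_atTop.1 h1
  refine ⟨max x₁ (4 / η), fun x hx => ?_⟩
  have h4 : 4 / η ≤ x := (le_max_right _ _).trans hx
  have hx0 : 0 < x := lt_of_lt_of_le (by positivity) h4
  constructor
  · rw [div_le_iff₀ hη] at h4
    rw [div_le_iff₀ hx0]; linarith
  · have := hx₁ x ((le_max_left _ _).trans hx)
    rw [Real.norm_of_nonneg (by positivity), Real.norm_of_nonneg (by positivity)] at this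
    rw [Real.exp_neg, ← div_eq_mul_inv, div_lt_one (Real.exp_pos _)]
    have := Real.exp_pos (η ^ 2 / 8 * x)
    linarith

/-- Claim: a balanced transverse partition `𝒴` with properties
(A)–(C) exists. -/
theorem balanced_transverse_partition (j k : ℕ) (hj : 1 ≤ j) (hjk : j < k)
    (ε : ℝ) (hε : 0 < ε) :
    ∃ β : ℝ, 0 < β ∧ β < 1 ∧ ∃ t₀ : ℕ, ∀ t : ℕ, t₀ ≤ t →
      ∀ (G : HGraph k) (P : Fin (mOf k t) → LoosePath k t G),
        (∀ i i' : Fin (mOf k t), i ≠ i' → Disjoint (P i).verts (P i').verts) →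
        G.MinDegOnGe j (Finset.univ.biUnion fun i => (P i).verts)
          ((looseHamThreshold j k + 3 * ε / 4) * (MOf k t : ℝ) ^ (k - j)) →
        ∃ Y : Fin (TOf k t) → Finset ℕ,
          (∀ h h' : Fin (TOf k t), h ≠ h' → Disjoint (Y h) (Y h')) ∧
          (Finset.univ.biUnion Y = Finset.univ.biUnion fun i => (P i).verts) ∧
          (∀ h, (Y h).card = mOf k t) ∧
          (∀ h, ∀ i : Fin (mOf k t), (Y h ∩ (P i).verts).card ≤ 1) ∧
          (∀ h, (Y h ∩ (Finset.univ.image fun i => (P i).endB)).card = mtOf k t) ∧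
          (∀ h, ((Y h ∩ (Finset.univ.image fun i => (P i).endA)).card : ℝ) ≤
            β * (mOf k t : ℝ)) ∧
          (∀ h, ∀ S ⊆ Finset.univ.biUnion fun i => (P i).verts, S.card = j →
            (looseHamThreshold j k + 5 * ε / 8) * (mOf k t : ℝ) ^ (k - j) ≤
              (G.degIn S (Y h) : ℝ)) := by
  refine ⟨1 / 2, by norm_num, by norm_num, ?_⟩
  obtain ⟨x₀, hx₀⟩ := aux_large (ε / 8) (by positivity) (3 * j + 1)
  refine ⟨max (max 2 k) ⌈x₀⌉₊, ?_⟩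
  intro t ht G P hdisj hdeg
  have ht2 : 2 ≤ t := (le_max_left 2 k).trans ((le_max_left _ _).trans ht)
  have htk : k ≤ t := (le_max_right 2 k).trans ((le_max_left _ _).trans ht)
  have htx : x₀ ≤ t := (Nat.le_ceil x₀).trans (by exact_mod_cast (le_max_right _ _).trans ht)
  have hT0 : TOf k t = t * (k - 1) + 1 := rfl
  have hm0 : mOf k t = TOf k t * mtOf k t := rfl
  haveI : NeZero (TOf k t) := ⟨by rw [hT0]; omega⟩
  have hNt2 : t ^ 2 ≤ mtOf k t := Nat.pow_le_pow_right (by omega) (by omega)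
  have hNt : t ≤ mtOf k t := le_trans (by nlinarith) hNt2
  have hTN : TOf k t ≤ mtOf k t := by
    refine le_trans ?_ hNt2
    obtain ⟨r, rfl⟩ : ∃ r, k = r + 1 := ⟨k - 1, by omega⟩
    rw [hT0]; simp only [Nat.add_sub_cancel]; nlinarith
  have hT2 : 2 ≤ TOf k t := by
    rw [hT0]
    have : 1 ≤ k - 1 := by omega
    nlinarith
  have hN : 0 < mtOf k t := by omega
  obtain ⟨hN1, hsm⟩ := hx₀ (mtOf k t) (htx.trans (by exact_mod_cast hNt))
  let eqv : Fin (TOf k t) × Fin (mtOf k t) ≃ Fin (mOf k t) := finProdFinEquiv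
  set vert : Fin (TOf k t) × Fin (mtOf k t) × Fin (TOf k t) → ℕ :=
    fun p => (P (eqv (p.1, p.2.1))).σ p.2.2 with hvert
  have hmemv : ∀ (i : Fin (mOf k t)) (r : Fin (TOf k t)), (P i).σ r ∈ (P i).verts := by
    intro i r
    exact mem_image.2 ⟨r, mem_range.2 r.2, rfl⟩
  have hinj : Function.Injective vert := by
    rintro ⟨q, g, r⟩ ⟨q', g', r'⟩ he
    simp only [hvert] at he
    have h1 : eqv (q, g) = eqv (q', g') := by
      by_contra hne
      refine disjoint_left.1 (hdisj _ _ hne) (hmemv _ r) ?_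
      rw [he]; exact hmemv _ r'
    rw [← h1] at he
    have h2 := (P (eqv (q, g))).injOn (Set.mem_Iio.2 r.2) (Set.mem_Iio.2 r'.2) he
    have h3 := eqv.injective h1
    simp only [Prod.mk.injEq] at h3
    rw [h3.1, h3.2, Fin.ext h2]
  have hV : (univ.biUnion fun i => (P i).verts) = univ.image vert := by
    ext v
    simp only [mem_biUnion, mem_univ, true_and, mem_image]
    constructor
    · rintro ⟨i, hi⟩
      obtain ⟨r, hr, rfl⟩ := mem_image.1 hi
      refine ⟨((eqv.symm i).1, (eqv.symm i).2, ⟨r, mem_range.1 hr⟩), ?_⟩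
      simp [hvert]
    · rintro ⟨p, rfl⟩
      exact ⟨_, hmemv _ _⟩
  rw [hV] at hdeg ⊢
  set V := univ.image vert with hVd
  have hVc : V.card = TOf k t * (mtOf k t * TOf k t) := by
    rw [hVd, card_image_of_injective _ hinj]; simp
  set F : Finset ℕ → Finset (Finset ℕ) := fun S =>
    ((G.inducedEdges V).filter fun e => S ⊆ e).image (fun e => e \ S) with hFd
  obtain ⟨Y, h1, h2, h3, h4, h5, h6⟩ := aux_geom vert hinj hN (powersetCard j V) F (k - j) (by omega)
    (by
      intro S hS f hf
      obtain ⟨e, he, rfl⟩ := mem_image.1 hf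
      rw [mem_filter, HGraph.inducedEdges, mem_filter] at he
      refine ⟨sdiff_subset.trans he.1.2, ?_⟩
      rw [card_sdiff_of_subset he.2, G.edge_card e he.1.1, (mem_powersetCard.1 hS).2])
    (looseHamThreshold j k + 3 * ε / 4) (ε / 8) (by positivity)
    (by
      intro S hS
      have := hdeg S (mem_powersetCard.1 hS).1 (mem_powersetCard.1 hS).2
      rw [hFd, card_image_of_injOn]
      · simpa [MOf, mOf] using this
      · intro e he e' he' hee
        have h1 := (mem_filter.1 (mem_coe.1 he)).2
        have h2 := (mem_filter.1 (mem_coe.1 he')).2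
        simp only at hee
        rw [← sdiff_union_of_subset h1, hee, sdiff_union_of_subset h2])
    hN1
    (by
      refine lt_of_le_of_lt ?_ hsm
      refine mul_le_mul_of_nonneg_right ?_ (Real.exp_pos _).le
      rw [card_powersetCard]
      have hVN : V.card ≤ mtOf k t ^ 3 := by
        rw [hVc]
        calc _ ≤ mtOf k t * (mtOf k t * mtOf k t) := by gcongr
          _ = _ := by ring
      have : V.card.choose j * TOf k t ≤ mtOf k t ^ (3 * j + 1) := by
        calc _ ≤ (mtOf k t ^ 3) ^ j * mtOf k t :=
              Nat.mul_le_mul ((Nat.choose_le_pow _ _).trans (Nat.pow_le_pow_left hVN _)) hTN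
          _ = _ := by rw [← pow_mul, pow_succ]
      exact_mod_cast this)
  have himg : ∀ r : Fin (TOf k t), (univ.image fun i => (P i).σ r) =
      univ.image fun p : Fin (TOf k t) × Fin (mtOf k t) => vert (p.1, p.2, r) := by
    intro r
    ext v
    simp only [mem_image, mem_univ, true_and, hvert]
    constructor
    · rintro ⟨i, rfl⟩
      exact ⟨eqv.symm i, by simp⟩
    · rintro ⟨p, rfl⟩
      exact ⟨_, rfl⟩
  refine ⟨Y, h1, h2, h3, ?_, ?_, ?_, ?_⟩
  · intro h i
    rw [card_le_one]
    intro a ha b hb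
    rw [mem_inter] at ha hb
    obtain ⟨r, hr, rfl⟩ := mem_image.1 ha.2
    obtain ⟨r', hr', rfl⟩ := mem_image.1 hb.2
    have := h4 h (eqv.symm i).1 (eqv.symm i).2 ⟨r, mem_range.1 hr⟩ ⟨r', mem_range.1 hr'⟩
      (by simpa [hvert] using ha.1) (by simpa [hvert] using hb.1)
    rw [Fin.mk.injEq] at this
    rw [this]
  · intro h
    have := h5 h ⟨t * (k - 1), by rw [hT0]; omega⟩
    rw [← himg] at this
    exact this
  · intro h
    have := h5 h ⟨0, by rw [hT0]; omega⟩
    rw [← himg] at this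
    have h' : (Y h ∩ (univ.image fun i => (P i).endA)).card = mtOf k t := this
    rw [h', hm0]
    push_cast
    have a1 : (2 : ℝ) ≤ TOf k t := by exact_mod_cast hT2
    have a2 : (0 : ℝ) < mtOf k t := by exact_mod_cast hN
    nlinarith
  · intro h S hS hSj
    have := h6 h S (mem_powersetCard.2 ⟨hS, hSj⟩)
    have e1 : looseHamThreshold j k + 5 * ε / 8 = looseHamThreshold j k + 3 * ε / 4 - ε / 8 := by
      ring
    rw [e1, hm0]
    push_cast
    refine this.trans ?_
    rw [HGraph.degIn]
    have hle : ((F S).filter fun f => f ⊆ Y h) ⊆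
        (G.edges.filter fun e => S ⊆ e ∧ e \ S ⊆ Y h).image (fun e => e \ S) := by
      intro f hf
      rw [mem_filter] at hf
      obtain ⟨e, he, rfl⟩ := mem_image.1 hf.1
      rw [mem_filter, HGraph.inducedEdges, mem_filter] at he
      exact mem_image.2 ⟨e, mem_filter.2 ⟨he.1.1, he.2, hf.2⟩, rfl⟩
    exact_mod_cast (card_le_card hle).trans card_image_le

end
end

section
/- For every α with 0 < α < 2/3 there exists n_0 such that for every n ≥ n_0 there exist an n-vertex 3-graph G with δ_2(G) ≥ αn and a colouring χ : E(G) → ℕ in which every colour appears on at most n edges, such that G contains no tight Hamilton cycle that is rainbow with respect to χ. -/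
open Finset

open scoped Classical

noncomputable section

def prPair (e : Finset ℕ) : Finset ℕ := e.filter fun x => ∃ y ∈ e, y ≠ x ∧ y % 3 = x % 3

lemma prPair_eq {a b c : ℕ} (hab : a ≠ b) (h : a % 3 = b % 3) (hc : c % 3 ≠ a % 3) :
    prPair {a, b, c} = {a, b} := by
  ext x
  simp only [prPair, mem_filter, mem_insert, mem_singleton]
  constructor
  · rintro ⟨rfl | rfl | rfl, y, rfl | rfl | rfl, h1, h2⟩ <;> first | omega | simp
  · rintro (rfl | rfl)
    · exact ⟨Or.inl rfl, b, by simp, hab.symm, h.symm⟩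
    · exact ⟨by simp, a, by simp, hab, h⟩

def exGraph (n : ℕ) : HGraph 3 where
  verts := range n
  edges := (powersetCard 3 (range n)).filter fun e =>
    ∃ a b c, a ≠ b ∧ a % 3 = b % 3 ∧ c % 3 ≠ a % 3 ∧ e = {a, b, c}
  edge_sub := fun e he => (mem_powersetCard.1 (mem_filter.1 he).1).1
  edge_card := fun e he => (mem_powersetCard.1 (mem_filter.1 he).1).2

lemma mem_exGraph {n a b c : ℕ} (ha : a < n) (hb : b < n) (hcn : c < n)
    (hab : a ≠ b) (h : a % 3 = b % 3) (hc : c % 3 ≠ a % 3) :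
    ({a, b, c} : Finset ℕ) ∈ (exGraph n).edges := by
  refine mem_filter.2 ⟨mem_powersetCard.2 ⟨?_, ?_⟩, a, b, c, hab, h, hc, rfl⟩
  · intro x hx
    simp only [mem_insert, mem_singleton] at hx
    rw [mem_range]; omega
  · rw [card_eq_three]
    exact ⟨a, b, c, hab, by rintro rfl; exact hc rfl, by rintro rfl; exact hc h.symm, rfl⟩

/-- distinct triple being an edge: exactly two residues -/
lemma edge_res {n a b c : ℕ} (he : ({a, b, c} : Finset ℕ) ∈ (exGraph n).edges) :
    (a % 3 = b % 3 ∨ a % 3 = c % 3 ∨ b % 3 = c % 3) ∧ ¬ (a % 3 = b % 3 ∧ b % 3 = c % 3) := by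
  obtain ⟨h3, x, y, z, hxy, h, hz, heq⟩ := mem_filter.1 he
  have hx : x ∈ ({a, b, c} : Finset ℕ) := by rw [heq]; simp
  have hy : y ∈ ({a, b, c} : Finset ℕ) := by rw [heq]; simp
  have hz' : z ∈ ({a, b, c} : Finset ℕ) := by rw [heq]; simp
  simp only [mem_insert, mem_singleton] at hx hy hz'
  constructor
  · rcases hx with rfl | rfl | rfl <;> rcases hy with rfl | rfl | rfl <;> omega
  · rintro ⟨h1, h2⟩
    rcases hx with rfl | rfl | rfl <;> rcases hz' with rfl | rfl | rfl <;> omega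

lemma card_res (n r : ℕ) (hr : r < 3) :
    2 * (n / 3) ≤ ((range n).filter fun x => x % 3 ≠ r).card := by
  have := card_le_card_of_injOn (s := range (2 * (n / 3)))
    (t := (range n).filter fun x => x % 3 ≠ r)
    (fun i => 3 * (i / 2) + (r + 1 + i % 2) % 3) ?_ ?_
  · simpa using this
  · intro i hi
    simp only [coe_range, Set.mem_Iio] at hi
    simp only [coe_filter, mem_range, Set.mem_setOf_eq]
    omega
  · intro i hi j hj hij
    simp only at hij
    omega

lemma deg_exGraph (n : ℕ) (T : Finset ℕ) (hT : T ⊆ range n) (h2 : T.card = 2) :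
    2 * (n / 3) ≤ (exGraph n).degOn T + 2 := by
  obtain ⟨a, b, hab, rfl⟩ := card_eq_two.1 h2
  have ha : a < n := mem_range.1 (hT (by simp))
  have hb : b < n := mem_range.1 (hT (by simp))
  obtain ⟨r, hr, hrr⟩ : ∃ r < 3, ∀ x, x % 3 ≠ r → (a % 3 = b % 3 → x % 3 ≠ a % 3) ∧
      (a % 3 ≠ b % 3 → x % 3 = a % 3 ∨ x % 3 = b % 3) := by
    by_cases h : a % 3 = b % 3
    · exact ⟨a % 3, Nat.mod_lt _ (by norm_num), fun x hx => ⟨fun _ => hx, fun h' => absurd h h'⟩⟩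
    · exact ⟨3 - a % 3 - b % 3, by omega, fun x hx => by omega⟩
  have h1 := card_res n r hr
  have h3 := le_card_sdiff ({a, b} : Finset ℕ) ((range n).filter fun x => x % 3 ≠ r)
  rw [h2] at h3
  have h4 : (((range n).filter fun x => x % 3 ≠ r) \ {a, b}).card ≤ (exGraph n).degOn {a, b} := by
    refine card_le_card_of_injOn (fun x => ({a, b, x} : Finset ℕ)) ?_ ?_
    · intro x hx
      simp only [coe_sdiff, coe_filter, mem_range, Set.mem_diff, Set.mem_setOf_eq, mem_coe,
        mem_insert, mem_singleton, not_or] at hx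
      obtain ⟨⟨hxn, hxr⟩, hxa, hxb⟩ := hx
      obtain ⟨p, q⟩ := hrr x hxr
      rw [mem_coe, mem_filter]
      refine ⟨?_, by intro y; simp; tauto⟩
      by_cases h : a % 3 = b % 3
      · exact mem_exGraph ha hb hxn hab h (p h)
      · rcases q h with h' | h'
        · have := mem_exGraph ha hxn hb (Ne.symm hxa) h'.symm (Ne.symm h)
          convert this using 1
          ext y; simp; tauto
        · have := mem_exGraph hb hxn ha (Ne.symm hxb) h'.symm h
          convert this using 1
          ext y; simp; tauto
    · intro x hx y hy hxy
      simp only [coe_sdiff, coe_filter, mem_range, Set.mem_diff, Set.mem_setOf_eq, mem_coe,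
        mem_insert, mem_singleton, not_or] at hx hy
      have : x ∈ ({a, b, y} : Finset ℕ) := by
        have hxy' : ({a, b, x} : Finset ℕ) = {a, b, y} := hxy
        rw [← hxy']; simp
      simp only [mem_insert, mem_singleton] at this
      tauto
  omega

lemma bounded_exGraph (n c : ℕ) :
    ((exGraph n).edges.filter fun e => Encodable.encode (prPair e) = c).card ≤ n := by
  rcases ((exGraph n).edges.filter fun e => Encodable.encode (prPair e) = c).eq_empty_or_nonempty
    with h | ⟨e₀, h₀⟩
  · rw [h]; simp
  · have key : ((exGraph n).edges.filter fun e => Encodable.encode (prPair e) = c) ⊆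
        (range n).image fun x => insert x (prPair e₀) := by
      intro e he
      obtain ⟨he, hc⟩ := mem_filter.1 he
      have hp : prPair e = prPair e₀ :=
        Encodable.encode_injective (hc.trans (mem_filter.1 h₀).2.symm)
      obtain ⟨h3, x, y, z, hxy, h, hz, rfl⟩ := mem_filter.1 he
      rw [mem_image]
      refine ⟨z, (exGraph n).edge_sub _ he (by simp), ?_⟩
      rw [← hp, prPair_eq hxy h hz]
      ext w; simp; tauto
    exact (card_le_card key).trans (card_image_le.trans (by simp))

lemma rot_triple (a b c : ℕ) : ({a, b, c} : Finset ℕ) = {b, c, a} := by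
  ext y; simp; tauto

lemma no_cycle (n : ℕ) (hn : 4 ≤ n) (σ : ℕ → ℕ) (hinj : Set.InjOn σ (Set.Iio n))
    (him : (range n).image σ = range n)
    (hE : ∀ i < n, ({σ i, σ ((i + 1) % n), σ ((i + 2) % n)} : Finset ℕ) ∈ (exGraph n).edges)
    (hR : RainbowEdges (fun e => Encodable.encode (prPair e)) ((Finset.range n).image fun i =>
      ({σ i, σ ((i + 1) % n), σ ((i + 2) % n)} : Finset ℕ))) : False := by
  have hpos : 0 < n := by omega
  set τ : ℕ → ℕ := fun i => σ (i % n) with hτ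
  have hmem : ∀ i, ({τ i, τ (i + 1), τ (i + 2)} : Finset ℕ) ∈ (Finset.range n).image fun i =>
      ({σ i, σ ((i + 1) % n), σ ((i + 2) % n)} : Finset ℕ) := by
    intro i
    rw [mem_image]
    exact ⟨i % n, mem_range.2 (Nat.mod_lt _ hpos), by simp [hτ, Nat.mod_add_mod]⟩
  have hE' : ∀ i, ({τ i, τ (i + 1), τ (i + 2)} : Finset ℕ) ∈ (exGraph n).edges := by
    intro i
    have := hE (i % n) (Nat.mod_lt _ hpos)
    simpa [hτ, Nat.mod_add_mod] using this
  have hne : ∀ i d, 0 < d → d < n → τ i ≠ τ (i + d) := by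
    intro i d hd hdn h
    have h1 : i % n = (i + d) % n := hinj (Nat.mod_lt _ hpos) (Nat.mod_lt _ hpos) h
    have h2 : i + 0 ≡ i + d [MOD n] := h1
    have h3 : 0 ≡ d [MOD n] := Nat.ModEq.add_left_cancel' i h2
    have h4 : 0 % n = d % n := h3
    rw [Nat.zero_mod, Nat.mod_eq_of_lt hdn] at h4
    omega
  have hstep : ∀ j, τ (j + 1) % 3 ≠ τ (j + 2) % 3 := by
    intro j h
    have e1 := edge_res (hE' j)
    have e2 := edge_res (hE' (j + 1))
    simp only [add_assoc, Nat.reduceAdd] at e2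
    have n12 := hne (j + 1) 1 (by omega) (by omega)
    have n03 := hne j 3 (by omega) (by omega)
    have n01 := hne j 1 (by omega) (by omega)
    have n02 := hne j 2 (by omega) (by omega)
    simp only [add_assoc, Nat.reduceAdd] at n12
    have m1 := hmem j
    have m2 := hmem (j + 1)
    simp only [add_assoc, Nat.reduceAdd] at m2
    have p1 : prPair {τ j, τ (j + 1), τ (j + 2)} = {τ (j + 1), τ (j + 2)} := by
      rw [rot_triple]
      exact prPair_eq n12 h (c := τ j) (by omega)
    have p2 : prPair {τ (j + 1), τ (j + 2), τ (j + 3)} = {τ (j + 1), τ (j + 2)} :=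
      prPair_eq n12 h (by omega)
    have := hR _ m1 _ m2 (by simp only [p1, p2])
    have hm : τ j ∈ ({τ (j + 1), τ (j + 2), τ (j + 3)} : Finset ℕ) := by
      rw [← this]; simp
    simp only [mem_insert, mem_singleton] at hm
    rcases hm with hm | hm | hm
    · exact n01 hm
    · exact n02 hm
    · exact n03 hm
  have hper : ∀ j, τ (j + 3) % 3 = τ (j + 1) % 3 := by
    intro j
    have e2 := edge_res (hE' (j + 1))
    have s1 := hstep j
    have s2 := hstep (j + 1)
    simp only [add_assoc, Nat.reduceAdd] at e2 s2
    omega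
  have htwo : ∀ j, (τ (j + 1) % 3 = τ 1 % 3 ∨ τ (j + 1) % 3 = τ 2 % 3) ∧
      (τ (j + 2) % 3 = τ 1 % 3 ∨ τ (j + 2) % 3 = τ 2 % 3) := by
    intro j
    induction j with
    | zero => simp
    | succ j ih =>
      have := hper j
      simp only [add_assoc, Nat.reduceAdd]
      omega
  have hall : ∀ v < n, v % 3 = τ 1 % 3 ∨ v % 3 = τ 2 % 3 := by
    intro v hv
    have : v ∈ (range n).image σ := by rw [him]; exact mem_range.2 hv
    obtain ⟨i, hi, rfl⟩ := mem_image.1 this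
    have h := (htwo (i + (n - 1))).1
    have e : τ (i + (n - 1) + 1) = σ i := by
      have : i + (n - 1) + 1 = i + n := by omega
      simp only [hτ, this, Nat.add_mod_right, Nat.mod_eq_of_lt (mem_range.1 hi)]
    rwa [e] at h
  have h0 := hall 0 (by omega)
  have h1 := hall 1 (by omega)
  have h2 := hall 2 (by omega)
  omega

/-- Example: 3-graphs with minimum codegree `αn`, `0 < α < 2/3`, and a
globally `n`-bounded colouring with no rainbow tight Hamilton cycle. -/
theorem no_rainbow_tight_hamilton_cycle (α : ℝ) (hα0 : 0 < α) (hα : α < 2 / 3) :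
    ∃ n₀ : ℕ, ∀ n : ℕ, n₀ ≤ n →
      ∃ (G : HGraph 3) (χ : Finset ℕ → ℕ),
        G.verts.card = n ∧
        (∀ T ⊆ G.verts, T.card = 2 → α * (n : ℝ) ≤ (G.degOn T : ℝ)) ∧
        (∀ c : ℕ, (G.edges.filter fun e => χ e = c).card ≤ n) ∧
        ∀ σ : ℕ → ℕ, Set.InjOn σ (Set.Iio n) →
          (Finset.range n).image σ = G.verts →
          (∀ i < n, ({σ i, σ ((i + 1) % n), σ ((i + 2) % n)} : Finset ℕ) ∈ G.edges) →
          ¬ RainbowEdges χ ((Finset.range n).image fun i =>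
              ({σ i, σ ((i + 1) % n), σ ((i + 2) % n)} : Finset ℕ)) := by
  obtain ⟨N, hN⟩ := exists_nat_gt (4 / (2 / 3 - α))
  refine ⟨max 4 N, fun n hn => ?_⟩
  have hn4 : 4 ≤ n := (le_max_left _ _).trans hn
  have hnN : N ≤ n := (le_max_right _ _).trans hn
  refine ⟨exGraph n, fun e => Encodable.encode (prPair e), card_range n, ?_,
    fun c => bounded_exGraph n c, ?_⟩
  · intro T hT h2
    have h := deg_exGraph n T hT h2
    have h' : 2 * n ≤ 3 * (exGraph n).degOn T + 10 := by omega
    have h'' : 2 * (n : ℝ) ≤ 3 * ((exGraph n).degOn T : ℝ) + 10 := by exact_mod_cast h'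
    have hNn : (N : ℝ) ≤ n := by exact_mod_cast hnN
    have h5 : 4 / (2 / 3 - α) < n := hN.trans_le hNn
    rw [div_lt_iff₀ (by linarith)] at h5
    linarith
  · intro σ hinj him hE hR
    exact no_cycle n hn4 σ hinj him hE hR

end
end
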